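/- Let w₁ : ℝ³ → Matrix (Fin 2) (Fin 2) ℂ be smooth in the variables (x₁, y₀, y₁). Set Q := diagonal(1, −1) and K := w₁Q − Qw₁, and for λ ∈ ℂ define the operators L₁(λ)Ψ := ∂_{x₁}Ψ − λQ·Ψ − K·Ψ and L₂(λ)Ψ := ∂_{y₁}Ψ − λ∂_{y₀}Ψ + (∂_{y₀}w₁)·Ψ acting on smooth maps Ψ : ℝ³ → Matrix (Fin 2) (Fin 2) ℂ. Then: (1) ∂_{y₀}K + [Q, ∂_{y₀}w₁] = 0 identically; (2) for every λ ∈ ℂ and smooth Ψ, L₁(λ)(L₂(λ)Ψ) − L₂(λ)(L₁(λ)Ψ) = (∂_{x₁}∂_{y₀}w₁ + ∂_{y₁}K − [K, ∂_{y₀}w₁])·Ψ, an expression independent of λ; consequently L₁(λ) and L₂(λ) commute for all λ if and only if w₁ satisfies the matrix equation ∂_{x₁}∂_{y₀}w₁ + ∂_{y₁}(w₁Q − Qw₁) = [w₁Q − Qw₁, ∂_{y₀}w₁]. -/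

import Mathlib

/-- Partial derivative of a matrix-valued function on `ℝ³` with respect to
coordinate `u`, taken entrywise. Coordinates: `0 = x₁`, `1 = y₀`, `2 = y₁`. -/
noncomputable def pd (u : Fin 3) (A : (Fin 3 → ℝ) → Matrix (Fin 2) (Fin 2) ℂ)
    (p : Fin 3 → ℝ) : Matrix (Fin 2) (Fin 2) ℂ :=
  Matrix.of fun i j => deriv (fun t => A (Function.update p u t) i j) (p u)

/-- All matrix entries are `C^∞`. -/
def IsSmoothMat (A : (Fin 3 → ℝ) → Matrix (Fin 2) (Fin 2) ℂ) : Prop :=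
  ∀ i j, ContDiff ℝ (⊤ : ℕ∞) fun p => A p i j

theorem IsSmoothMat.hasDerivAt_update {A : (Fin 3 → ℝ) → Matrix (Fin 2) (Fin 2) ℂ}
    (hA : IsSmoothMat A) (u : Fin 3) (p : Fin 3 → ℝ) (i j : Fin 2) :
    HasDerivAt (fun t => A (Function.update p u t) i j)
      (fderiv ℝ (fun q => A q i j) p (Pi.single u 1)) (p u) := by
  have hd : DifferentiableAt ℝ (fun q => A q i j) (Function.update p u (p u)) :=
    (hA i j).differentiable (by simp) _
  have h := hd.hasFDerivAt.comp_hasDerivAt (p u) (_root_.hasDerivAt_update p u (p u))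
  rwa [Function.update_eq_self] at h

theorem IsSmoothMat.pd_apply {A : (Fin 3 → ℝ) → Matrix (Fin 2) (Fin 2) ℂ}
    (hA : IsSmoothMat A) (u : Fin 3) (p : Fin 3 → ℝ) (i j : Fin 2) :
    pd u A p i j = fderiv ℝ (fun q => A q i j) p (Pi.single u 1) :=
  (hA.hasDerivAt_update u p i j).deriv

theorem IsSmoothMat.hasDerivAt_pd {A : (Fin 3 → ℝ) → Matrix (Fin 2) (Fin 2) ℂ}
    (hA : IsSmoothMat A) (u : Fin 3) (p : Fin 3 → ℝ) (i j : Fin 2) :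
    HasDerivAt (fun t => A (Function.update p u t) i j) (pd u A p i j) (p u) :=
  hA.pd_apply u p i j ▸ hA.hasDerivAt_update u p i j

theorem pd_eq_of_hasDerivAt {A : (Fin 3 → ℝ) → Matrix (Fin 2) (Fin 2) ℂ} {u : Fin 3}
    {p : Fin 3 → ℝ} {M : Matrix (Fin 2) (Fin 2) ℂ}
    (h : ∀ i j, HasDerivAt (fun t => A (Function.update p u t) i j) (M i j) (p u)) :
    pd u A p = M := by
  ext i j
  exact (h i j).deriv

theorem IsSmoothMat.isSmoothMat_pd {A : (Fin 3 → ℝ) → Matrix (Fin 2) (Fin 2) ℂ}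
    (hA : IsSmoothMat A) (u : Fin 3) : IsSmoothMat (pd u A) := by
  intro i j
  simp only [hA.pd_apply u _ i j]
  exact ((hA i j).fderiv_right (by simp)).clm_apply contDiff_const

theorem IsSmoothMat.pd_comm {A : (Fin 3 → ℝ) → Matrix (Fin 2) (Fin 2) ℂ}
    (hA : IsSmoothMat A) (u v : Fin 3) (p : Fin 3 → ℝ) :
    pd u (pd v A) p = pd v (pd u A) p := by
  ext i j
  have hd : DifferentiableAt ℝ (fderiv ℝ fun q => A q i j) p :=
    ((hA i j).fderiv_right (m := 1) (WithTop.coe_le_coe.2 le_top)).differentiable (by simp) p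
  have hs : IsSymmSndFDerivAt ℝ (fun q => A q i j) p :=
    (hA i j).contDiffAt.isSymmSndFDerivAt (by
      rw [minSmoothness_of_isRCLikeNormedField]
      exact WithTop.coe_le_coe.2 le_top)
  rw [(hA.isSmoothMat_pd v).pd_apply, (hA.isSmoothMat_pd u).pd_apply]
  simp only [hA.pd_apply _ _ i j]
  rw [fderiv_clm_apply hd (differentiableAt_const _), fderiv_clm_apply hd (differentiableAt_const _)]
  simpa using hs (Pi.single u 1) (Pi.single v 1)

theorem IsSmoothMat.const (M : Matrix (Fin 2) (Fin 2) ℂ) : IsSmoothMat fun _ => M :=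
  fun _ _ => contDiff_const

section

variable {A B : (Fin 3 → ℝ) → Matrix (Fin 2) (Fin 2) ℂ}

theorem IsSmoothMat.add (hA : IsSmoothMat A) (hB : IsSmoothMat B) :
    IsSmoothMat fun p => A p + B p :=
  fun i j => (hA i j).add (hB i j)

theorem IsSmoothMat.sub (hA : IsSmoothMat A) (hB : IsSmoothMat B) :
    IsSmoothMat fun p => A p - B p :=
  fun i j => (hA i j).sub (hB i j)

theorem IsSmoothMat.smul (c : ℂ) (hA : IsSmoothMat A) : IsSmoothMat fun p => c • A p :=
  fun i j => contDiff_const.mul (hA i j)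

theorem IsSmoothMat.mul (hA : IsSmoothMat A) (hB : IsSmoothMat B) :
    IsSmoothMat fun p => A p * B p := by
  intro i j
  simp only [Matrix.mul_apply]
  exact ContDiff.sum fun k _ => (hA i k).mul (hB k j)

theorem pd_const (u : Fin 3) (M : Matrix (Fin 2) (Fin 2) ℂ) (p : Fin 3 → ℝ) :
    pd u (fun _ => M) p = 0 :=
  pd_eq_of_hasDerivAt fun _ _ => hasDerivAt_const _ _

theorem IsSmoothMat.pd_add (hA : IsSmoothMat A) (hB : IsSmoothMat B) (u : Fin 3)
    (p : Fin 3 → ℝ) : pd u (fun q => A q + B q) p = pd u A p + pd u B p :=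
  pd_eq_of_hasDerivAt fun i j => (hA.hasDerivAt_pd u p i j).add (hB.hasDerivAt_pd u p i j)

theorem IsSmoothMat.pd_sub (hA : IsSmoothMat A) (hB : IsSmoothMat B) (u : Fin 3)
    (p : Fin 3 → ℝ) : pd u (fun q => A q - B q) p = pd u A p - pd u B p :=
  pd_eq_of_hasDerivAt fun i j => (hA.hasDerivAt_pd u p i j).sub (hB.hasDerivAt_pd u p i j)

theorem IsSmoothMat.pd_smul (hA : IsSmoothMat A) (c : ℂ) (u : Fin 3) (p : Fin 3 → ℝ) :
    pd u (fun q => c • A q) p = c • pd u A p :=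
  pd_eq_of_hasDerivAt fun i j => (hA.hasDerivAt_pd u p i j).const_mul c

/-- The Leibniz rule for matrix products. -/
theorem IsSmoothMat.pd_mul (hA : IsSmoothMat A) (hB : IsSmoothMat B) (u : Fin 3)
    (p : Fin 3 → ℝ) :
    pd u (fun q => A q * B q) p = pd u A p * B p + A p * pd u B p := by
  refine pd_eq_of_hasDerivAt fun i j => ?_
  simp only [Matrix.mul_apply, Matrix.add_apply, ← Finset.sum_add_distrib]
  refine HasDerivAt.fun_sum fun k _ => ?_
  simpa using (hA.hasDerivAt_pd u p i k).fun_mul (hB.hasDerivAt_pd u p k j)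

end

/-- The Lax pair `L₁(λ) = ∂_{x₁} − λQ − K`, `L₂(λ) = ∂_{y₁} − λ∂_{y₀} + (∂_{y₀}w₁)` of the
(2+1)-dimensional NLS equation: the `λ`-dependent part of the commutator cancels, and the
two operators commute for all `λ` iff `w₁` satisfies the matrix (2+1)-dimensional NLS
equation. -/
theorem stmt5
    (w1 : (Fin 3 → ℝ) → Matrix (Fin 2) (Fin 2) ℂ) (hw1 : IsSmoothMat w1)
    (Q : Matrix (Fin 2) (Fin 2) ℂ) (hQ : Q = Matrix.diagonal ![1, -1])
    (K : (Fin 3 → ℝ) → Matrix (Fin 2) (Fin 2) ℂ)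
    (hK : ∀ p, K p = w1 p * Q - Q * w1 p)
    (L1 L2 : ℂ → ((Fin 3 → ℝ) → Matrix (Fin 2) (Fin 2) ℂ) →
      (Fin 3 → ℝ) → Matrix (Fin 2) (Fin 2) ℂ)
    (hL1 : ∀ lam Ψ p, L1 lam Ψ p = pd 0 Ψ p - lam • (Q * Ψ p) - K p * Ψ p)
    (hL2 : ∀ lam Ψ p, L2 lam Ψ p = pd 2 Ψ p - lam • pd 1 Ψ p + pd 1 w1 p * Ψ p) :
    (∀ p, pd 1 K p + (Q * pd 1 w1 p - pd 1 w1 p * Q) = 0)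
    ∧ (∀ (lam : ℂ) (Ψ : (Fin 3 → ℝ) → Matrix (Fin 2) (Fin 2) ℂ), IsSmoothMat Ψ → ∀ p,
        L1 lam (L2 lam Ψ) p - L2 lam (L1 lam Ψ) p
          = (pd 0 (pd 1 w1) p + pd 2 K p
            - (K p * pd 1 w1 p - pd 1 w1 p * K p)) * Ψ p)
    ∧ ((∀ (lam : ℂ) (Ψ : (Fin 3 → ℝ) → Matrix (Fin 2) (Fin 2) ℂ), IsSmoothMat Ψ → ∀ p,
          L1 lam (L2 lam Ψ) p = L2 lam (L1 lam Ψ) p)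
        ↔ ∀ p, pd 0 (pd 1 w1) p + pd 2 (fun q => w1 q * Q - Q * w1 q) p
            = K p * pd 1 w1 p - pd 1 w1 p * K p) := by
  obtain rfl : K = fun p => w1 p * Q - Q * w1 p := funext hK
  have cQ := IsSmoothMat.const Q
  have hKs : IsSmoothMat fun p => w1 p * Q - Q * w1 p := (hw1.mul cQ).sub (cQ.mul hw1)
  have hV := hw1.isSmoothMat_pd 1
  have pdK : ∀ u p, pd u (fun p => w1 p * Q - Q * w1 p) p = pd u w1 p * Q - Q * pd u w1 p := by
    intro u p
    rw [(hw1.mul cQ).pd_sub (cQ.mul hw1), hw1.pd_mul cQ, cQ.pd_mul hw1, pd_const]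
    simp
  have key : ∀ (lam : ℂ) (Ψ : (Fin 3 → ℝ) → Matrix (Fin 2) (Fin 2) ℂ), IsSmoothMat Ψ → ∀ p,
      L1 lam (L2 lam Ψ) p - L2 lam (L1 lam Ψ) p
        = (pd 0 (pd 1 w1) p + pd 2 (fun p => w1 p * Q - Q * w1 p) p
          - ((w1 p * Q - Q * w1 p) * pd 1 w1 p - pd 1 w1 p * (w1 p * Q - Q * w1 p))) * Ψ p := by
    intro lam Ψ hΨ p
    have e1 : L1 lam Ψ = fun p => pd 0 Ψ p - lam • (Q * Ψ p) - (w1 p * Q - Q * w1 p) * Ψ p :=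
      funext (hL1 lam Ψ)
    have e2 : L2 lam Ψ = fun p => pd 2 Ψ p - lam • pd 1 Ψ p + pd 1 w1 p * Ψ p :=
      funext (hL2 lam Ψ)
    have d1 : ∀ u, pd u (L1 lam Ψ) p = pd u (pd 0 Ψ) p - lam • (Q * pd u Ψ p)
        - ((pd u w1 p * Q - Q * pd u w1 p) * Ψ p + (w1 p * Q - Q * w1 p) * pd u Ψ p) := by
      intro u
      rw [e1, ((hΨ.isSmoothMat_pd 0).sub ((cQ.mul hΨ).smul lam)).pd_sub (hKs.mul hΨ),
        (hΨ.isSmoothMat_pd 0).pd_sub ((cQ.mul hΨ).smul lam), (cQ.mul hΨ).pd_smul, cQ.pd_mul hΨ, pd_const,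
        hKs.pd_mul hΨ, pdK, zero_mul, zero_add]
    have d2 : pd 0 (L2 lam Ψ) p = pd 0 (pd 2 Ψ) p - lam • pd 0 (pd 1 Ψ) p
        + (pd 0 (pd 1 w1) p * Ψ p + pd 1 w1 p * pd 0 Ψ p) := by
      rw [e2, ((hΨ.isSmoothMat_pd 2).sub ((hΨ.isSmoothMat_pd 1).smul lam)).pd_add (hV.mul hΨ),
        (hΨ.isSmoothMat_pd 2).pd_sub ((hΨ.isSmoothMat_pd 1).smul lam), (hΨ.isSmoothMat_pd 1).pd_smul, hV.pd_mul hΨ]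
    rw [hL1, hL2 lam (L1 lam Ψ), d1, d1, d2, pdK, hΨ.pd_comm 2 0, hΨ.pd_comm 1 0, e1, e2]
    simp only [mul_sub, sub_mul, mul_add, add_mul, smul_sub, smul_add, mul_smul_comm,
      mul_assoc]
    abel
  refine ⟨fun p => by rw [pdK]; abel, key, fun h p => ?_, fun h lam Ψ hΨ p => ?_⟩
  · have hp := key 0 (fun _ => 1) (IsSmoothMat.const 1) p
    rw [h 0 _ (IsSmoothMat.const 1) p, sub_self, mul_one] at hp
    exact sub_eq_zero.mp hp.symm
  · rw [← sub_eq_zero, key lam Ψ hΨ p, h p, sub_self, zero_mul]
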